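/- Let K be a simple augmented directed complex and let a' ≤ a'' be separated sequences of n-dimensional basis elements of K. Then an ordered sequence b of (n+1)-dimensional basis elements bridges a' and a'' if and only if, identifying b with the corresponding element of K_{n+1}*, one has ∂b = a'' − a'. -/

import Mathlib

/-- The data of a globular set: a dimension function together with
source (`src`) and target (`tgt`) operations. -/
structure GlobData where
  X : Type
  dim : X → ℕ
  src : X → X
  tgt : X → X

namespace GlobData

/-- The generating relation: `∂⁻y < y` (for `|y| > 0`) and `x < ∂⁺x` (for `|x| > 0`). -/
def rel (G : GlobData) (x y : G.X) : Prop :=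
  (0 < G.dim y ∧ x = G.src y) ∨ (0 < G.dim x ∧ y = G.tgt x)

/-- The transitive closure of the generating relation. -/
def lt (G : GlobData) : G.X → G.X → Prop :=
  Relation.TransGen G.rel

def le (G : GlobData) (x y : G.X) : Prop :=
  G.lt x y ∨ x = y

end GlobData

/-- A simple globular set: nonempty, finite, the source/target operations lower
dimension by one, the globular identities hold, and the transitive closure of the
generating relation is a (strict) total ordering. -/
def IsSimpleGlobular (G : GlobData) : Prop :=
  Nonempty G.X ∧ Finite G.X ∧
  (∀ x, 0 < G.dim x → G.dim (G.src x) + 1 = G.dim x) ∧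
  (∀ x, 0 < G.dim x → G.dim (G.tgt x) + 1 = G.dim x) ∧
  (∀ x, 2 ≤ G.dim x → G.src (G.src x) = G.src (G.tgt x)) ∧
  (∀ x, 2 ≤ G.dim x → G.tgt (G.src x) = G.tgt (G.tgt x)) ∧
  (∀ x, ¬ G.lt x x) ∧
  (∀ x y, G.lt x y ∨ x = y ∨ G.lt y x)

/-- The data of an augmented directed complex with basis: a graded set `B` of basis
elements, the boundary `d b` of each basis element (a finitely supported `ℤ`-linear
combination of basis elements), and the augmentation `eps b` of each basis element
(only relevant in dimension `0`).  The chain group `K_q` is the free abelian group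
on the basis elements of dimension `q` and the distinguished submonoid `K_q*` is the
set of nonnegative combinations of such basis elements. -/
structure PreADC where
  B : Type
  dim : B → ℕ
  d : B → (B →₀ ℤ)
  eps : B → ℤ

namespace PreADC

/-- The positive part `∂⁺x` of a chain. -/
noncomputable def posPart {B : Type} (x : B →₀ ℤ) : B →₀ ℤ :=
  Finsupp.mapRange (fun c => max c 0) (by simp) x

/-- The negative part `∂⁻x` of a chain. -/
noncomputable def negPart {B : Type} (x : B →₀ ℤ) : B →₀ ℤ :=
  Finsupp.mapRange (fun c => max (-c) 0) (by simp) x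

/-- The boundary of a chain, extended linearly from basis elements. -/
noncomputable def bnd (K : PreADC) (x : K.B →₀ ℤ) : K.B →₀ ℤ :=
  x.sum fun a c => c • K.d a

/-- The augmentation of a chain (applied to its degree-zero part). -/
noncomputable def aug (K : PreADC) (x : K.B →₀ ℤ) : ℤ :=
  x.sum fun a c => if K.dim a = 0 then c * K.eps a else 0

/-- `∂⁻` of a chain. -/
noncomputable def dMinus (K : PreADC) (x : K.B →₀ ℤ) : K.B →₀ ℤ :=
  negPart (K.bnd x)

/-- `∂⁺` of a chain. -/
noncomputable def dPlus (K : PreADC) (x : K.B →₀ ℤ) : K.B →₀ ℤ :=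
  posPart (K.bnd x)

/-- The axioms of an augmented directed complex with basis: the boundary of a basis
element lowers dimension by exactly one (and vanishes in dimension `0`), `∂∂ = 0`,
and `ε∂ = 0`. -/
def IsADC (K : PreADC) : Prop :=
  (∀ b, K.dim b = 0 → K.d b = 0) ∧
  (∀ b a, (K.d b) a ≠ 0 → K.dim a + 1 = K.dim b) ∧
  (∀ b, K.bnd (K.d b) = 0) ∧
  (∀ b, K.dim b = 1 → K.aug (K.d b) = 0)

/-- The basis is unital: `ε((∂⁻)^{|b|} b) = ε((∂⁺)^{|b|} b) = 1` for all basis elements. -/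
def Unital (K : PreADC) : Prop :=
  ∀ b : K.B,
    K.aug ((K.dMinus)^[K.dim b] (Finsupp.single b 1)) = 1 ∧
    K.aug ((K.dPlus)^[K.dim b] (Finsupp.single b 1)) = 1

/-- The basis is loop-free: for each `q` there is a (strict) partial ordering `r`
such that `a r b` whenever `a` is a term of `(∂⁻)^{|b|-q} b` with `|b| > q`, or `b`
is a term of `(∂⁺)^{|a|-q} a` with `|a| > q`. -/
def LoopFree (K : PreADC) : Prop :=
  ∀ q : ℕ, ∃ r : K.B → K.B → Prop,
    (∀ a b c, r a b → r b c → r a c) ∧ (∀ a, ¬ r a a) ∧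
    (∀ a b, q < K.dim b → ((K.dMinus)^[K.dim b - q] (Finsupp.single b 1)) a ≠ 0 → r a b) ∧
    (∀ a b, q < K.dim a → ((K.dPlus)^[K.dim a - q] (Finsupp.single a 1)) b ≠ 0 → r a b)

/-- The basis is strongly loop-free: there is a (strict) partial ordering `r` on the
whole basis such that `a r b` whenever `a` is a term of `∂⁻b` or `b` is a term of `∂⁺a`. -/
def StronglyLoopFree (K : PreADC) : Prop :=
  ∃ r : K.B → K.B → Prop,
    (∀ a b c, r a b → r b c → r a c) ∧ (∀ a, ¬ r a a) ∧
    (∀ a b, (negPart (K.d b)) a ≠ 0 → r a b) ∧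
    (∀ a b, (posPart (K.d a)) b ≠ 0 → r a b)

/-- `f` (given by its values on basis elements, extended linearly) is a chain map
preserving the grading and taking sums of basis elements to sums of basis elements
(equivalently `f(K_q*) ⊆ L_q*`). -/
def IsMor (K L : PreADC) (f : K.B → (L.B →₀ ℤ)) : Prop :=
  (∀ b a, (f b) a ≠ 0 → L.dim a = K.dim b) ∧
  (∀ b, ((K.d b).sum fun a c => c • f a) = L.bnd (f b)) ∧
  (∀ b a, 0 ≤ (f b) a)

/-- A morphism of augmented directed complexes: a chain map as in `IsMor` which is
moreover augmentation-preserving. -/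
def IsAugMor (K L : PreADC) (f : K.B → (L.B →₀ ℤ)) : Prop :=
  IsMor K L f ∧ ∀ b, K.dim b = 0 → L.aug (f b) = K.eps b

end PreADC

/-- The simple augmented directed complex generated by a (simple) globular set:
basis the elements of `X`, `∂x = ∂⁺x - ∂⁻x` for positive-dimensional `x`,
and `εx = 1` on zero-dimensional basis elements. -/
noncomputable def GlobData.toADC (G : GlobData) : PreADC where
  B := G.X
  dim := G.dim
  d := fun b =>
    if 0 < G.dim b then
      Finsupp.single (G.tgt b) 1 - Finsupp.single (G.src b) 1
    else 0
  eps := fun _ => 1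

/-- An ordered sequence of `n`-dimensional basis elements. -/
def OrderedSeq (G : GlobData) (n : ℕ) (l : List G.X) : Prop :=
  (∀ a ∈ l, G.dim a = n) ∧ l.Chain' G.le

/-- A separated sequence of `n`-dimensional basis elements: ordered, and each
consecutive pair of terms encloses a basis element of dimension `< n`. -/
def SeparatedSeq (G : GlobData) (n : ℕ) (l : List G.X) : Prop :=
  OrderedSeq G n l ∧ l.Chain' (fun a b => ∃ c, G.lt a c ∧ G.lt c b ∧ G.dim c < n)

/-- The element of `K_n*` corresponding to a sequence of basis elements:
the sum of its terms. -/
noncomputable def chainOf (G : GlobData) (l : List G.X) : G.X →₀ ℤ :=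
  (l.map fun a => Finsupp.single a (1 : ℤ)).sum

/-- The partial ordering of separated sequences of `n`-dimensional basis elements:
same length, termwise `≤`, and all basis elements strictly between corresponding
terms have dimension `≥ n`. -/
def sepLe (G : GlobData) (n : ℕ) (l l' : List G.X) : Prop :=
  List.Forall₂ (fun a a' => G.le a a' ∧ ∀ c, G.lt a c → G.lt c a' → n ≤ G.dim c) l l'

/-- `Interleaves G n x y b` says: if `A` is the (strictly increasing) enumeration of
the `n`-dimensional basis elements `c` with `x ≤ c ≤ y`, then `b` interleaves `A`:
`b = (b_1, …, b_q)` with `A_{j-1} < b_j < A_j` for all `j`. -/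
def Interleaves (G : GlobData) (n : ℕ) (x y : G.X) (b : List G.X) : Prop :=
  ∃ A : List G.X, A.Chain' G.lt ∧
    (∀ c, c ∈ A ↔ (G.dim c = n ∧ G.le x c ∧ G.le c y)) ∧
    List.Forall₂ (fun (pr : G.X × G.X) c => G.lt pr.1 c ∧ G.lt c pr.2) (A.zip A.tail) b

/-- A sequence `b` of `(n+1)`-dimensional basis elements bridges the separated
sequences `a'` and `a''`: it is a concatenation of blocks, the `i`-th block
interleaving the `n`-dimensional elements between `a_i'` and `a_i''`. -/
def Bridges (G : GlobData) (n : ℕ) (a' a'' b : List G.X) : Prop :=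
  a'.length = a''.length ∧
  (∀ c ∈ b, G.dim c = n + 1) ∧
  ∃ bs : List (List G.X), b = bs.flatten ∧
    List.Forall₂ (fun (pr : G.X × G.X) bi => Interleaves G n pr.1 pr.2 bi) (a'.zip a'') bs

namespace GlobData

variable {G : GlobData}

lemma lt_trans' {x y z : G.X} (hxy : G.lt x y) (hyz : G.lt y z) : G.lt x z :=
  Relation.TransGen.trans hxy hyz

/-- The total order on a simple globular set. -/
noncomputable abbrev linearOrder (h : IsSimpleGlobular G) : LinearOrder G.X where
  lt := G.lt
  le := G.le
  le_refl x := Or.inr rfl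
  le_trans := by
    rintro x y z (hxy | rfl) (hyz | rfl)
    · exact Or.inl (lt_trans' hxy hyz)
    · exact Or.inl hxy
    · exact Or.inl hyz
    · exact Or.inr rfl
  lt_iff_le_not_ge x y := by
    have hirr := h.2.2.2.2.2.2.1
    constructor
    · intro hxy
      refine ⟨Or.inl hxy, ?_⟩
      rintro (hyx | rfl)
      · exact hirr x (lt_trans' hxy hyx)
      · exact hirr _ hxy
    · rintro ⟨hxy | rfl, hyx⟩
      · exact hxy
      · exact absurd (Or.inr rfl) hyx
  le_antisymm := by
    rintro x y (hxy | rfl) (hyx | hyx)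
    · exact absurd (lt_trans' hxy hyx) (h.2.2.2.2.2.2.1 x)
    · exact hyx.symm
    · rfl
    · rfl
  le_total x y := by
    rcases h.2.2.2.2.2.2.2 x y with hxy | rfl | hxy
    · exact Or.inl (Or.inl hxy)
    · exact Or.inl (Or.inr rfl)
    · exact Or.inr (Or.inl hxy)
  toDecidableLE := Classical.decRel _

lemma src_lt {x : G.X} (hx : 0 < G.dim x) : G.lt (G.src x) x :=
  Relation.TransGen.single (Or.inl ⟨hx, rfl⟩)

lemma lt_tgt {x : G.X} (hx : 0 < G.dim x) : G.lt x (G.tgt x) :=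
  Relation.TransGen.single (Or.inr ⟨hx, rfl⟩)

lemma dim_le_of_src_lt_of_lt (h : IsSimpleGlobular G) (b : G.X) :
    0 < G.dim b → ∀ c, G.lt (G.src b) c → G.lt c b → G.dim b ≤ G.dim c := by
  obtain ⟨-, hfin, hsrc, htgt, hss, -, hirr, htri⟩ := h
  have : IsTrans G.X G.lt := ⟨fun _ _ _ => lt_trans'⟩
  have : Std.Irrefl G.lt := ⟨hirr⟩
  have wf : WellFounded G.lt := Finite.wellFounded_of_trans_of_irrefl G.lt
  induction b using wf.induction with
  | _ b ih =>
  intro hb c hbc hcb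
  rcases Relation.TransGen.tail'_iff.1 hcb with ⟨p, hcp, hpb⟩
  rcases hpb with ⟨-, rfl⟩ | ⟨hp, rfl⟩
  · rcases Relation.reflTransGen_iff_eq_or_transGen.1 hcp with hcp | hcp
    · subst hcp; exact absurd hbc (hirr _)
    · exact absurd (lt_trans' hbc hcp) (hirr _)
  · have hd := htgt p hp
    have hd' := hsrc p hp
    rcases Relation.reflTransGen_iff_eq_or_transGen.1 hcp with hcp | hcp
    · subst hcp; omega
    · rw [← hss p (by omega)] at hbc
      rcases htri c (G.src p) with hc | hc | hc
      · have := ih (G.src p) (lt_trans' (src_lt hp) (lt_tgt hp)) (by omega) c hbc hc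
        omega
      · subst hc; omega
      · have := ih p (lt_tgt hp) hp c hc hcp
        omega

lemma dim_le_of_lt_of_lt_tgt (h : IsSimpleGlobular G) (b : G.X) :
    0 < G.dim b → ∀ c, G.lt b c → G.lt c (G.tgt b) → G.dim b ≤ G.dim c := by
  obtain ⟨-, hfin, hsrc, htgt, -, htt, hirr, htri⟩ := h
  have : IsTrans G.X (Function.swap G.lt) := ⟨fun _ _ _ hxy hyz => lt_trans' hyz hxy⟩
  have : Std.Irrefl (Function.swap G.lt) := ⟨hirr⟩
  have wf : WellFounded (Function.swap G.lt) := Finite.wellFounded_of_trans_of_irrefl _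
  induction b using wf.induction with
  | _ b ih =>
  intro hb c hbc hcb
  rcases Relation.TransGen.head'_iff.1 hbc with ⟨p, hbp, hpc⟩
  rcases hbp with ⟨hp, rfl⟩ | ⟨-, rfl⟩
  · have hd := htgt p hp
    have hd' := hsrc p hp
    rcases Relation.reflTransGen_iff_eq_or_transGen.1 hpc with hpc | hpc
    · subst hpc; omega
    · rw [htt p (by omega)] at hcb
      rcases htri c (G.tgt p) with hc | hc | hc
      · have := ih p (src_lt hp) hp c hpc hc
        omega
      · subst hc; omega
      · have := ih (G.tgt p) (lt_trans' (src_lt hp) (lt_tgt hp)) (by omega) c hc hcb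
        omega
  · rcases Relation.reflTransGen_iff_eq_or_transGen.1 hpc with hpc | hpc
    · subst hpc; exact absurd hcb (hirr _)
    · exact absurd (lt_trans' hcb hpc) (hirr _)

lemma bnd_chainOf (l : List G.X) (hl : ∀ e ∈ l, 0 < G.dim e) :
    G.toADC.bnd (chainOf G l) = chainOf G (l.map G.tgt) - chainOf G (l.map G.src) := by
  classical
  have hadd : ∀ x y : G.X →₀ ℤ, G.toADC.bnd (x + y) = G.toADC.bnd x + G.toADC.bnd y := by
    intro x y
    exact Finsupp.sum_add_index' (fun _ => zero_smul _ _) (fun _ _ _ => add_smul _ _ _)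
  induction l with
  | nil =>
    simp only [chainOf, List.map_nil, List.sum_nil, sub_zero]
    exact Finsupp.sum_zero_index
  | cons e l ih =>
    have hcons : ∀ (a : G.X) (l : List G.X),
        chainOf G (a :: l) = Finsupp.single a 1 + chainOf G l := fun a l => by simp [chainOf]
    have hs : G.toADC.bnd (Finsupp.single e (1 : ℤ) : G.X →₀ ℤ) =
        (Finsupp.single (G.tgt e) 1 - Finsupp.single (G.src e) 1 : G.X →₀ ℤ) := by
      have hsum : G.toADC.bnd (Finsupp.single e (1 : ℤ) : G.X →₀ ℤ) = (1 : ℤ) • G.toADC.d e :=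
        Finsupp.sum_single_index (h := fun a c => c • G.toADC.d a) (zero_smul ℤ (G.toADC.d e))
      rw [hsum, one_smul]
      exact if_pos (hl e (by simp))
    rw [hcons, hadd, hs, ih fun e he => hl e (by simp [he])]
    simp only [List.map_cons, hcons]
    abel

end GlobData

/-- The sources and targets of `(n+1)`-dimensional elements are `n`-dimensional, and each
`(n+1)`-dimensional element is enclosed by its source and target with nothing of dimension
`≤ n` in between. -/
def EnclosedByFaces {X : Type} [LinearOrder X] (dim : X → ℕ) (src tgt : X → X) (n : ℕ) : Prop :=
  ∀ e, dim e = n + 1 → dim (src e) = n ∧ dim (tgt e) = n ∧ src e < e ∧ e < tgt e ∧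
    ∀ c, src e < c → c < tgt e → n + 1 ≤ dim c

lemma IsSimpleGlobular.enclosedByFaces {G : GlobData} (h : IsSimpleGlobular G) (n : ℕ) :
    letI := GlobData.linearOrder h
    EnclosedByFaces G.dim G.src G.tgt n := by
  intro e he
  have hpos : 0 < G.dim e := by omega
  have h1 := h.2.2.1 e hpos
  have h2 := h.2.2.2.1 e hpos
  refine ⟨by omega, by omega, GlobData.src_lt hpos, GlobData.lt_tgt hpos, fun c hc hc' => ?_⟩
  rcases h.2.2.2.2.2.2.2 c e with hce | rfl | hce
  · exact he ▸ GlobData.dim_le_of_src_lt_of_lt h e hpos c hc hce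
  · exact he.ge
  · exact he ▸ GlobData.dim_le_of_lt_of_lt_tgt h e hpos c hce hc'

namespace EnclosedByFaces

variable {X : Type} [LinearOrder X] {dim : X → ℕ} {src tgt : X → X} {n : ℕ}

lemma le_src (H : EnclosedByFaces dim src tgt n) {e u : X} (he : dim e = n + 1)
    (hu : dim u = n) (hlt : u < tgt e) : u ≤ src e := by
  by_contra! hcon
  have := (H e he).2.2.2.2 u hcon hlt
  omega

lemma tgt_le (H : EnclosedByFaces dim src tgt n) {e u : X} (he : dim e = n + 1)
    (hu : dim u = n) (hlt : src e < u) : tgt e ≤ u := by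
  by_contra! hcon
  have := (H e he).2.2.2.2 u hlt hcon
  omega

lemma tgt_mono (H : EnclosedByFaces dim src tgt n) {e f : X} (he : dim e = n + 1)
    (hf : dim f = n + 1) (hef : e ≤ f) : tgt e ≤ tgt f := by
  obtain ⟨-, -, h1, -, -⟩ := H e he
  obtain ⟨-, h2, -, h3, -⟩ := H f hf
  exact H.tgt_le he h2 (h1.trans_le (hef.trans h3.le))

open Classical in
/-- The indicator of the `n`-dimensional elements `≥ u` that are not separated from `u` by an
element of dimension `< n`. -/
noncomputable def upInd (dim : X → ℕ) (n : ℕ) (u v : X) : ℤ :=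
  if dim v = n ∧ u ≤ v ∧ ∀ c, u < c → c < v → n ≤ dim c then 1 else 0

lemma upInd_tgt_sub_src (H : EnclosedByFaces dim src tgt n) {e u : X} (he : dim e = n + 1)
    (hu : dim u = n) :
    upInd dim n u (tgt e) - upInd dim n u (src e) = if tgt e = u then 1 else 0 := by
  obtain ⟨h1, h2, h3, h4, h5⟩ := H e he
  unfold upInd
  by_cases heu : tgt e = u
  · subst heu
    have ht : dim (tgt e) = n ∧ tgt e ≤ tgt e ∧ ∀ c, tgt e < c → c < tgt e → n ≤ dim c :=
      ⟨h2, le_rfl, fun c hc hc' => absurd hc hc'.not_gt⟩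
    rw [if_pos ht, if_pos rfl, if_neg]
    · rfl
    · rintro ⟨-, hle, -⟩
      exact (h3.trans h4).not_ge hle
  · rw [if_neg heu, sub_eq_zero]
    congr 1
    refine propext ⟨?_, ?_⟩
    · rintro ⟨-, hle, hc⟩
      refine ⟨h1, H.le_src he hu (lt_of_le_of_ne hle (Ne.symm heu)), fun c huc hcs => ?_⟩
      exact hc c huc (hcs.trans (h3.trans h4))
    · rintro ⟨-, hle, hc⟩
      refine ⟨h2, hle.trans (h3.trans h4).le, fun c huc hcs => ?_⟩
      rcases lt_trichotomy c (src e) with hlt | rfl | hlt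
      · exact hc c huc hlt
      · exact h1.ge
      · exact (Nat.le_succ n).trans (h5 c hlt hcs)

lemma upInd_sub {u x y : X} (hx : dim x = n) (hy : dim y = n)
    (hxy : x ≤ y) (hb : ∀ c, x < c → c < y → n ≤ dim c) :
    upInd dim n u y - upInd dim n u x = if x < u ∧ u ≤ y then 1 else 0 := by
  unfold upInd
  by_cases h : x < u ∧ u ≤ y
  · rw [if_pos h, if_pos ⟨hy, h.2, fun c huc hcy => hb c (h.1.trans huc) hcy⟩, if_neg]
    · rfl
    · rintro ⟨-, hle, -⟩
      exact h.1.not_ge hle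
  · rw [if_neg h, sub_eq_zero]
    congr 1
    refine propext ⟨?_, ?_⟩
    · rintro ⟨-, hle, hc⟩
      have hux : u ≤ x := by
        by_contra! hcon
        exact h ⟨hcon, hle⟩
      exact ⟨hx, hux, fun c huc hcx => hc c huc (hcx.trans_le hxy)⟩
    · rintro ⟨-, hle, hc⟩
      refine ⟨hy, hle.trans hxy, fun c huc hcy => ?_⟩
      rcases lt_trichotomy c x with hlt | rfl | hlt
      · exact hc c huc hlt
      · exact hx.ge
      · exact hb c hlt hcy

/-- A sequence interleaving the enumeration of the `n`-dimensional elements of `[x, y]` has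
boundary `y - x`. -/
lemma sum_faces_of_interleaves (H : EnclosedByFaces dim src tgt n) {y : X} (hy : dim y = n)
    (A : List X) : ∀ (x : X) (b : List X), (x :: A).Pairwise (· < ·) →
    x ≤ y → (∀ c, c ∈ x :: A ↔ dim c = n ∧ x ≤ c ∧ c ≤ y) →
    List.Forall₂ (fun (p : X × X) c => p.1 < c ∧ c < p.2) ((x :: A).zip A) b →
    (∀ e ∈ b, dim e = n + 1) →
    (b.map fun e => (Finsupp.single (tgt e) 1 : X →₀ ℤ)).sum -
      (b.map fun e => (Finsupp.single (src e) 1 : X →₀ ℤ)).sum =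
      Finsupp.single y 1 - Finsupp.single x 1 := by
  induction A with
  | nil =>
    intro x b _ hxy hmem hf _
    have : y = x := by simpa using (hmem y).2 ⟨hy, hxy, le_rfl⟩
    subst this
    cases hf
    simp
  | cons c A ih =>
    intro x b hp hxy hmem hf hd
    rw [List.zip_cons_cons] at hf
    obtain ⟨e, b', ⟨hxe, hec⟩, hf', rfl⟩ := List.forall₂_cons_left_iff.1 hf
    rw [List.pairwise_cons] at hp
    have hdc := (hmem c).1 (by simp)
    have hdx := (hmem x).1 (by simp)
    have hxc := hp.1 c (by simp)
    have hde := hd e (by simp)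
    obtain ⟨h1, h2, h3, h4, h5⟩ := H e hde
    have hcons : ∀ u, dim u = n → x < u → u < c → False := by
      intro u hu hxu huc
      have hm := (hmem u).2 ⟨hu, hxu.le, huc.le.trans hdc.2.2⟩
      simp only [List.mem_cons] at hm
      rcases hm with rfl | rfl | hm
      · exact hxu.false
      · exact huc.false
      · exact (huc.trans ((List.pairwise_cons.1 hp.2).1 u hm)).false
    have hsx : src e = x := by
      have := H.le_src hde hdx.1 (hxe.trans h4)
      rcases this.eq_or_lt with h | h
      · exact h.symm
      · exact (hcons _ h1 h (h3.trans hec)).elim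
    have htc : tgt e = c := by
      have := H.tgt_le hde hdc.1 (h3.trans hec)
      rcases this.eq_or_lt with h | h
      · exact h
      · exact (hcons _ h2 (hxe.trans h4) h).elim
    have hmem' : ∀ u, u ∈ c :: A ↔ dim u = n ∧ c ≤ u ∧ u ≤ y := by
      intro u
      constructor
      · intro hu
        have := (hmem u).1 (List.mem_cons_of_mem _ hu)
        refine ⟨this.1, ?_, this.2.2⟩
        rcases List.mem_cons.1 hu with rfl | hu
        · exact le_rfl
        · exact ((List.pairwise_cons.1 hp.2).1 u hu).le
      · rintro ⟨hu, hcu, huy⟩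
        rcases List.mem_cons.1 ((hmem u).2 ⟨hu, hxc.le.trans hcu, huy⟩) with rfl | h
        · exact absurd hcu hxc.not_ge
        · exact h
    have := ih c b' hp.2 hdc.2.2 hmem' hf' fun f hf => hd f (by simp [hf])
    simp only [List.map_cons, List.sum_cons, hsx, htc]
    rw [add_sub_add_comm, this]
    abel

/-- Elements whose targets are the terms of an increasing sequence of `n`-dimensional elements
interleave that sequence. -/
lemma forall₂_of_map_tgt (H : EnclosedByFaces dim src tgt n) (U : List X) :
    ∀ (x : X) (b : List X), (x :: U).Pairwise (· < ·) → dim x = n → b.map tgt = U →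
    (∀ e ∈ b, dim e = n + 1) →
    List.Forall₂ (fun (p : X × X) c => p.1 < c ∧ c < p.2) ((x :: U).zip U) b := by
  induction U with
  | nil =>
    intro x b _ _ hb _
    rw [List.map_eq_nil_iff] at hb
    subst hb
    simp
  | cons c U ih =>
    intro x b hp hx hb hd
    obtain ⟨e, b', rfl, rfl, hb'⟩ := List.map_eq_cons_iff.1 hb
    rw [List.pairwise_cons] at hp
    have hde := hd e (by simp)
    obtain ⟨h1, h2, h3, h4, h5⟩ := H e hde
    rw [List.zip_cons_cons]
    refine List.Forall₂.cons ⟨?_, h4⟩ (ih _ b' hp.2 h2 hb' fun f hf => hd f (by simp [hf]))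
    exact (H.le_src hde hx (hp.1 _ (by simp))).trans_lt h3

open Classical in
/-- The increasing enumeration of the `n`-dimensional elements `u` with `x < u ≤ y`. -/
noncomputable def enumIoc [Fintype X] (dim : X → ℕ) (n : ℕ) (x y : X) : List X :=
  (Finset.univ.filter fun u => dim u = n ∧ x < u ∧ u ≤ y).sort

lemma mem_enumIoc [Fintype X] {x y u : X} :
    u ∈ enumIoc dim n x y ↔ dim u = n ∧ x < u ∧ u ≤ y := by
  simp [enumIoc]

lemma pairwise_enumIoc [Fintype X] (x y : X) : (enumIoc dim n x y).Pairwise (· < ·) :=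
  (Finset.sortedLT_sort _).pairwise

lemma count_enumIoc [Fintype X] {x y u : X} (hu : dim u = n) :
    ((enumIoc dim n x y).count u : ℤ) = if x < u ∧ u ≤ y then 1 else 0 := by
  have hnd : (enumIoc dim n x y).Nodup := (pairwise_enumIoc x y).imp fun h => h.ne
  rw [hnd.count]
  simp [mem_enumIoc, hu]

/-- The targets of a chain with boundary `∑ (yᵢ - xᵢ)` are the `n`-dimensional elements of the
intervals `(xᵢ, yᵢ]`. -/
lemma map_tgt_eq_flatMap [Fintype X] (H : EnclosedByFaces dim src tgt n) (L : List (X × X))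
    (b : List X) (hbd : ∀ e ∈ b, dim e = n + 1) (hb : b.Pairwise (· ≤ ·))
    (hL : ∀ p ∈ L, dim p.1 = n ∧ dim p.2 = n ∧ p.1 ≤ p.2 ∧
      ∀ c, p.1 < c → c < p.2 → n ≤ dim c)
    (hLs : L.Pairwise fun p q => p.2 ≤ q.1)
    (heq : ∀ φ : X → ℤ, (b.map fun e => φ (tgt e) - φ (src e)).sum =
      (L.map fun p => φ p.2 - φ p.1).sum) :
    b.map tgt = L.flatMap fun p => enumIoc dim n p.1 p.2 := by
  have hs1 : (b.map tgt).Pairwise (· ≤ ·) := by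
    rw [List.pairwise_map]
    exact hb.imp_of_mem fun he hf hef => H.tgt_mono (hbd _ he) (hbd _ hf) hef
  have hs2 : (L.flatMap fun p => enumIoc dim n p.1 p.2).Pairwise (· ≤ ·) := by
    rw [List.pairwise_flatMap]
    refine ⟨fun p _ => (pairwise_enumIoc _ _).imp le_of_lt, hLs.imp fun hpq u hu v hv => ?_⟩
    exact ((mem_enumIoc.1 hu).2.2.trans hpq).trans (mem_enumIoc.1 hv).2.1.le
  refine List.Perm.eq_of_pairwise' hs1 hs2 (List.perm_iff_count.2 fun u => ?_)
  by_cases hu : dim u = n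
  · have hc : ∀ l : List X, ((l.count u : ℕ) : ℤ) =
        (l.map fun v => if v = u then (1 : ℤ) else 0).sum := by
      intro l
      induction l with
      | nil => simp
      | cons a l ih =>
        simp only [List.count_cons, List.map_cons, List.sum_cons, ← ih, beq_iff_eq]
        push_cast
        ring
    have key := heq (upInd dim n u)
    rw [List.map_congr_left fun e he => H.upInd_tgt_sub_src (hbd e he) hu,
      List.map_congr_left fun p hp =>
        (upInd_sub (hL p hp).1 (hL p hp).2.1 (hL p hp).2.2.1 (hL p hp).2.2.2).trans
          (count_enumIoc (dim := dim) hu).symm] at key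
    zify
    rw [hc, List.map_map, List.count_flatMap]
    refine key.trans ?_
    rw [Nat.cast_list_sum, List.map_map]
    rfl
  · rw [List.count_eq_zero_of_not_mem, List.count_eq_zero_of_not_mem]
    · simp only [List.mem_flatMap, not_exists, not_and]
      exact fun p _ hp => hu (mem_enumIoc.1 hp).1
    · simp only [List.mem_map, not_exists, not_and]
      rintro e he rfl
      exact hu (H e (hbd e he)).2.1

end EnclosedByFaces

lemma sum_map_sub_eq {α : Type} (f g : α → ℤ) (l : List α) :
    (l.map fun a => f a - g a).sum = (l.map f).sum - (l.map g).sum := by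
  simpa using Multiset.sum_map_sub (m := (l : Multiset α)) (f := f) (g := g)

lemma exists_flatten_of_map_eq_flatMap {α β γ : Type} (f : α → β) (g : γ → List β)
    (R : γ → List α → Prop) (L : List γ) :
    ∀ b : List α, (∀ p ∈ L, ∀ c ⊆ b, c.map f = g p → R p c) → b.map f = L.flatMap g →
      ∃ bs : List (List α), b = bs.flatten ∧ List.Forall₂ R L bs := by
  induction L with
  | nil =>
    intro b _ hb
    exact ⟨[], by simpa using hb, .nil⟩
  | cons p L ih =>
    intro b hR hb
    rw [List.flatMap_cons] at hb
    obtain ⟨b₁, b₂, rfl, h₁, h₂⟩ := List.map_eq_append_iff.1 hb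
    obtain ⟨bs, rfl, hbs⟩ := ih b₂ (fun q hq c hc => hR q (List.mem_cons_of_mem _ hq) c
      fun _ hx => List.mem_append_right _ (hc hx)) h₂
    exact ⟨b₁ :: bs, rfl, .cons (hR p (by simp) b₁ (fun _ hx => List.mem_append_left _ hx) h₁) hbs⟩

section Bridging

variable {G : GlobData} {n : ℕ}

lemma chainOf_cons (a : G.X) (l : List G.X) :
    chainOf G (a :: l) = Finsupp.single a 1 + chainOf G l := by
  simp [chainOf]

lemma chainOf_append (l l' : List G.X) :
    chainOf G (l ++ l') = chainOf G l + chainOf G l' := by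
  simp [chainOf]

lemma Interleaves.chainOf_sub (h : IsSimpleGlobular G) {x y : G.X} {b : List G.X}
    (hx : G.dim x = n) (hy : G.dim y = n) (hxy : G.le x y) (hbd : ∀ e ∈ b, G.dim e = n + 1)
    (hb : Interleaves G n x y b) :
    chainOf G (b.map G.tgt) - chainOf G (b.map G.src) =
      Finsupp.single y 1 - Finsupp.single x 1 := by
  let _ := GlobData.linearOrder h
  obtain ⟨A, hA, hmem, hf⟩ := hb
  have hp : A.Pairwise (· < ·) := List.isChain_iff_pairwise.1 hA
  have hxA : x ∈ A := (hmem x).2 ⟨hx, Or.inr rfl, hxy⟩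
  obtain _ | ⟨z, A⟩ := A
  · simp at hxA
  have hzx : z = x := by
    rcases List.mem_cons.1 hxA with h | h
    · exact h.symm
    · exact absurd ((List.pairwise_cons.1 hp).1 x h)
        (not_lt_of_ge ((hmem z).1 (by simp)).2.1)
  subst hzx
  have := (h.enclosedByFaces n).sum_faces_of_interleaves hy A z b hp hxy hmem hf hbd
  simpa only [chainOf, List.map_map, Function.comp_def] using this

lemma chainOf_sub_of_forall₂_interleaves (h : IsSimpleGlobular G) {a' a'' : List G.X}
    (hle : sepLe G n a' a'') :
    ∀ bs : List (List G.X), (∀ a ∈ a', G.dim a = n) → (∀ a ∈ a'', G.dim a = n) →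
    (∀ e ∈ bs.flatten, G.dim e = n + 1) →
    List.Forall₂ (fun (p : G.X × G.X) b => Interleaves G n p.1 p.2 b) (a'.zip a'') bs →
    chainOf G (bs.flatten.map G.tgt) - chainOf G (bs.flatten.map G.src) =
      chainOf G a'' - chainOf G a' := by
  induction hle with
  | nil =>
    intro bs _ _ _ hf
    cases hf
    simp
  | @cons x y a' a'' hxy _ ih =>
    intro bs h' h'' hd hf
    rw [List.zip_cons_cons] at hf
    obtain ⟨b, bs, hb, hf', rfl⟩ := List.forall₂_cons_left_iff.1 hf
    have h1 := ih bs (fun a ha => h' a (by simp [ha])) (fun a ha => h'' a (by simp [ha]))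
      (fun e he => hd e (by simp only [List.flatten_cons, List.mem_append]; exact Or.inr he)) hf'
    have h2 := hb.chainOf_sub h (h' x (by simp)) (h'' y (by simp)) hxy.1
      fun e he => hd e (by simp [he])
    simp only [List.flatten_cons, List.map_append, chainOf_append, chainOf_cons]
    rw [add_sub_add_comm, h1, h2]
    abel

lemma SeparatedSeq.pairwise {l : List G.X} (hl : SeparatedSeq G n l) :
    l.Pairwise fun a b => ∃ c, G.lt a c ∧ G.lt c b ∧ G.dim c < n := by
  have : Trans (fun a b : G.X => ∃ c, G.lt a c ∧ G.lt c b ∧ G.dim c < n)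
      (fun a b => ∃ c, G.lt a c ∧ G.lt c b ∧ G.dim c < n)
      (fun a b => ∃ c, G.lt a c ∧ G.lt c b ∧ G.dim c < n) :=
    ⟨fun ⟨c, h1, h2, h3⟩ ⟨_, h4, h5, _⟩ =>
      ⟨c, h1, GlobData.lt_trans' h2 (GlobData.lt_trans' h4 h5), h3⟩⟩
  exact List.isChain_iff_pairwise.1 hl.2

lemma sepLe.pairwise_zip (h : IsSimpleGlobular G) {a' a'' : List G.X} (hle : sepLe G n a' a'') :
    a'.Pairwise (fun a b => ∃ c, G.lt a c ∧ G.lt c b ∧ G.dim c < n) →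
    (a'.zip a'').Pairwise fun p q => G.le p.2 q.1 := by
  let _ := GlobData.linearOrder h
  induction hle with
  | nil => simp
  | @cons x y a' a'' hxy _ ih =>
    intro hp
    rw [List.pairwise_cons] at hp
    rw [List.zip_cons_cons, List.pairwise_cons]
    refine ⟨?_, ih hp.2⟩
    rintro ⟨u, v⟩ huv
    obtain ⟨c, hxc, hcu, hcn⟩ := hp.1 u (List.of_mem_zip huv).1
    have hyc : y ≤ c := by
      by_contra! hcy
      exact hcn.not_ge (hxy.2 c hxc hcy)
    exact hyc.trans (le_of_lt hcu)

end Bridging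

/-- For separated sequences `a' ≤ a''` of `n`-dimensional basis elements of a simple
augmented directed complex, an ordered sequence `b` of `(n+1)`-dimensional basis
elements bridges `a'` and `a''` if and only if `∂b = a'' - a'`. -/
theorem stmt9 (G : GlobData) (h : IsSimpleGlobular G) (n : ℕ)
    (a' a'' : List G.X)
    (h' : SeparatedSeq G n a') (h'' : SeparatedSeq G n a'')
    (hle : sepLe G n a' a'')
    (b : List G.X) (hb : OrderedSeq G (n + 1) b) :
    Bridges G n a' a'' b ↔
      G.toADC.bnd (chainOf G b) = chainOf G a'' - chainOf G a' := by
  have hbd := hb.1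
  rw [GlobData.bnd_chainOf b fun e he => by rw [hbd e he]; omega]
  constructor
  · rintro ⟨-, -, bs, rfl, hf⟩
    exact chainOf_sub_of_forall₂_interleaves h hle bs h'.1.1 h''.1.1 hbd hf
  · intro heq
    let _ := GlobData.linearOrder h
    have := h.2.1
    let _ := Fintype.ofFinite G.X
    have H := h.enclosedByFaces n
    have hlen : a'.length = a''.length := List.Forall₂.length_eq hle
    refine ⟨hlen, hbd, ?_⟩
    have hL : ∀ p ∈ a'.zip a'', G.dim p.1 = n ∧ G.dim p.2 = n ∧ p.1 ≤ p.2 ∧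
        ∀ c, p.1 < c → c < p.2 → n ≤ G.dim c := by
      rintro ⟨x, y⟩ hp
      have hxy := List.forall₂_iff_zip.1 hle |>.2 hp
      exact ⟨h'.1.1 x (List.of_mem_zip hp).1, h''.1.1 y (List.of_mem_zip hp).2, hxy.1, hxy.2⟩
    have hφ : ∀ φ : G.X → ℤ, (b.map fun e => φ (G.tgt e) - φ (G.src e)).sum =
        ((a'.zip a'').map fun p => φ p.2 - φ p.1).sum := by
      intro φ
      have hch : ∀ l : List G.X,
          Finsupp.linearCombination ℤ φ (chainOf G l) = (l.map φ).sum := by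
        intro l
        simp [chainOf, map_list_sum, List.map_map, Function.comp_def]
      have := congrArg (Finsupp.linearCombination ℤ φ) heq
      rw [map_sub, map_sub, hch, hch, hch, hch, List.map_map, List.map_map] at this
      rw [sum_map_sub_eq, sum_map_sub_eq]
      refine this.trans ?_
      rw [← Function.comp_def φ Prod.fst, ← Function.comp_def φ Prod.snd,
        ← List.map_map, ← List.map_map, List.map_fst_zip hlen.le, List.map_snd_zip hlen.ge]
    have hmap := H.map_tgt_eq_flatMap (a'.zip a'') b hbd (List.isChain_iff_pairwise.1 hb.2) hL
      (sepLe.pairwise_zip h hle h'.pairwise) hφ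
    refine exists_flatten_of_map_eq_flatMap _ _ _ _ b (fun p hp c hc hcm => ?_) hmap
    obtain ⟨h1, h2, h3, -⟩ := hL p hp
    have hpw : (p.1 :: EnclosedByFaces.enumIoc G.dim n p.1 p.2).Pairwise (· < ·) :=
      List.pairwise_cons.2 ⟨fun u hu => (EnclosedByFaces.mem_enumIoc.1 hu).2.1,
        EnclosedByFaces.pairwise_enumIoc _ _⟩
    refine ⟨_, hpw.isChain, fun u => ?_,
      H.forall₂_of_map_tgt _ _ c hpw h1 hcm fun e he => hbd e (hc he)⟩
    rw [List.mem_cons, EnclosedByFaces.mem_enumIoc]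
    change _ ↔ _ ∧ p.1 ≤ u ∧ u ≤ p.2
    constructor
    · rintro (rfl | ⟨hu, hlt, hle⟩)
      · exact ⟨h1, le_rfl, h3⟩
      · exact ⟨hu, hlt.le, hle⟩
    · rintro ⟨hu, hle, hle'⟩
      rcases hle.eq_or_lt with h | h
      · exact Or.inl h.symm
      · exact Or.inr ⟨hu, h, hle'⟩
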